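/- Let $\mathbb G$ be a step-2 Carnot group of rank $m$ in exponential coordinates, $\mathbb W=\{x_1=0\}$, $\mathbb L$ the $x_1$-axis, and let $\phi:U\to\mathbb{R}$ be continuous on an open $U\subseteq\mathbb W$. Suppose $\phi$ is a distributional solution of $D^\phi_\ell\phi=\omega$ on $U$ for some $\omega\in L^1_{loc}(U)$ and some $2\le\ell\le m$, where $D^\phi_\ell=\partial_{x_\ell}-\sum_{i=1}^h\big(b^{(i)}_{\ell 1}\phi+\tfrac12\sum_{k=2}^m x_k b^{(i)}_{\ell k}\big)\partial_{y^*_i}$. Then for every $q\in\mathbb G$, the translated function $\phi_q$ is a distributional solution of $D^{\phi_q}_\ell\phi_q=\omega\circ P_{q^{-1}}$ on $P_q(U)$. -/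

import Mathlib

open Matrix MeasureTheory

/-- The step-2 Carnot group product on `ℝ^(m+1) × ℝ^h` determined by the
skew-symmetric matrices `B i`. -/
noncomputable def step2Mul {m h : ℕ} (B : Fin h → Matrix (Fin (m + 1)) (Fin (m + 1)) ℝ)
    (p q : (Fin (m + 1) → ℝ) × (Fin h → ℝ)) : (Fin (m + 1) → ℝ) × (Fin h → ℝ) :=
  (p.1 + q.1, fun i => p.2 i + q.2 i - (1 / 2) * dotProduct ((B i).mulVec p.1) q.1)

/-- The group inverse. -/
def step2Inv {m h : ℕ} (p : (Fin (m + 1) → ℝ) × (Fin h → ℝ)) :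
    (Fin (m + 1) → ℝ) × (Fin h → ℝ) := (-p.1, -p.2)

/-- Projection onto `𝕎 = {x₁ = 0}`. -/
noncomputable def step2ProjW {m h : ℕ} (B : Fin h → Matrix (Fin (m + 1)) (Fin (m + 1)) ℝ)
    (p : (Fin (m + 1) → ℝ) × (Fin h → ℝ)) : (Fin (m + 1) → ℝ) × (Fin h → ℝ) :=
  ((fun j => if j = 0 then 0 else p.1 j),
   (fun i => p.2 i - (1 / 2) * ∑ j, B i j 0 * p.1 j * p.1 0))

/-- Identification of `𝕎` with `ℝ^m × ℝ^h`. -/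
def step2Emb {m h : ℕ} (w : (Fin m → ℝ) × (Fin h → ℝ)) : (Fin (m + 1) → ℝ) × (Fin h → ℝ) :=
  (Fin.cons 0 w.1, w.2)

/-- Coordinates on `𝕎`. -/
def step2Strip {m h : ℕ} (p : (Fin (m + 1) → ℝ) × (Fin h → ℝ)) : (Fin m → ℝ) × (Fin h → ℝ) :=
  (Fin.tail p.1, p.2)

/-- The map `P_q(w) = π_𝕎(q ⬝ w)` in coordinates on `𝕎`. -/
noncomputable def step2Pmap {m h : ℕ} (B : Fin h → Matrix (Fin (m + 1)) (Fin (m + 1)) ℝ)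
    (q : (Fin (m + 1) → ℝ) × (Fin h → ℝ)) (w : (Fin m → ℝ) × (Fin h → ℝ)) :
    (Fin m → ℝ) × (Fin h → ℝ) :=
  step2Strip (step2ProjW B (step2Mul B q (step2Emb w)))

/-- `φ` is a distributional solution of `D^φ_ℓ φ = ω` on `U ⊆ 𝕎`, where
`D^φ_ℓ = ∂_{x_ℓ} - ∑ᵢ (b^{(i)}_{ℓ1} φ + ½ ∑ₖ xₖ b^{(i)}_{ℓk}) ∂_{y*ᵢ}`
(all derivatives, including of the quadratic term `φ²/2`, are moved to the test function). -/
noncomputable def IsDistrSol {m h : ℕ} (B : Fin h → Matrix (Fin (m + 1)) (Fin (m + 1)) ℝ)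
    (ℓ : Fin m) (U : Set ((Fin m → ℝ) × (Fin h → ℝ)))
    (φ ω : ((Fin m → ℝ) × (Fin h → ℝ)) → ℝ) : Prop :=
  ∀ ξ : ((Fin m → ℝ) × (Fin h → ℝ)) → ℝ,
    ContDiff ℝ (⊤ : ℕ∞) ξ → HasCompactSupport ξ → tsupport ξ ⊆ U →
    ∫ w in U,
      (-(φ w) * fderiv ℝ ξ w (Pi.single ℓ 1, 0)
        + ∑ i, ((1 / 2) * B i ℓ.succ 0 * (φ w) ^ 2
                + (1 / 2) * (∑ k : Fin m, w.1 k * B i ℓ.succ k.succ) * φ w)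
            * fderiv ℝ ξ w (0, Pi.single i 1))
    = ∫ w in U, ω w * ξ w

/-- Linear coefficients of `P_q`. -/
noncomputable def pL {m h : ℕ} (B : Fin h → Matrix (Fin (m + 1)) (Fin (m + 1)) ℝ)
    (q : (Fin (m + 1) → ℝ) × (Fin h → ℝ)) (i : Fin h) (k : Fin m) : ℝ :=
  (1 / 2) * (∑ j : Fin m, B i k.succ j.succ * q.1 j.succ) + q.1 0 * B i k.succ 0

/-- Translation part of `P_q`. -/
noncomputable def pC {m h : ℕ} (B : Fin h → Matrix (Fin (m + 1)) (Fin (m + 1)) ℝ)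
    (q : (Fin (m + 1) → ℝ) × (Fin h → ℝ)) : (Fin m → ℝ) × (Fin h → ℝ) :=
  (fun k => q.1 k.succ,
    fun i => q.2 i - (1 / 2) * q.1 0 * ∑ k : Fin m, q.1 k.succ * B i k.succ 0)

/-- Linear part of `P_q`. -/
noncomputable def pA {m h : ℕ} (B : Fin h → Matrix (Fin (m + 1)) (Fin (m + 1)) ℝ)
    (q : (Fin (m + 1) → ℝ) × (Fin h → ℝ)) :
    ((Fin m → ℝ) × (Fin h → ℝ)) →L[ℝ] ((Fin m → ℝ) × (Fin h → ℝ)) :=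
  LinearMap.toContinuousLinearMap
    { toFun := fun w => (w.1, fun i => w.2 i - ∑ k, w.1 k * pL B q i k)
      map_add' := by
        intro u v
        ext i
        · simp
        · simp only [Prod.fst_add, Prod.snd_add, Pi.add_apply, add_mul, Finset.sum_add_distrib]
          ring
      map_smul' := by
        intro c v
        ext i
        · simp
        · simp only [Prod.smul_fst, Prod.smul_snd, Pi.smul_apply, smul_eq_mul, mul_assoc,
            ← Finset.mul_sum, RingHom.id_apply]
          ring }

theorem pA_apply {m h : ℕ} (B : Fin h → Matrix (Fin (m + 1)) (Fin (m + 1)) ℝ)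
    (q : (Fin (m + 1) → ℝ) × (Fin h → ℝ)) (w : (Fin m → ℝ) × (Fin h → ℝ)) :
    pA B q w = (w.1, fun i => w.2 i - ∑ k, w.1 k * pL B q i k) := rfl

theorem skew_apply {m h : ℕ} {B : Fin h → Matrix (Fin (m + 1)) (Fin (m + 1)) ℝ}
    (hskew : ∀ i, (B i)ᵀ = -(B i)) (i : Fin h) (j k : Fin (m + 1)) : B i j k = - B i k j := by
  have := congrFun (congrFun (hskew i) k) j
  simpa using this

theorem pmap_eq {m h : ℕ} {B : Fin h → Matrix (Fin (m + 1)) (Fin (m + 1)) ℝ}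
    (hskew : ∀ i, (B i)ᵀ = -(B i)) (q : (Fin (m + 1) → ℝ) × (Fin h → ℝ))
    (w : (Fin m → ℝ) × (Fin h → ℝ)) :
    step2Pmap B q w = pA B q w + pC B q := by
  ext i
  · simp [step2Pmap, step2Strip, step2ProjW, step2Mul, step2Emb, pA_apply, pC, Fin.tail]
    ring
  · have h0 : B i 0 0 = 0 := by have := skew_apply hskew i 0 0; linarith
    simp only [step2Pmap, step2Strip, step2ProjW, step2Mul, step2Emb, pA_apply, pC, pL,
      dotProduct, mulVec, Fin.sum_univ_succ, Pi.add_apply, Fin.cons_zero, Fin.cons_succ, h0,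
      Prod.snd_add, mul_add, add_mul, Finset.sum_add_distrib, Finset.mul_sum, Finset.sum_mul]
    have e1 : ∑ x : Fin m, 1 / 2 * (B i x.succ 0 * q.1 0 * w.1 x)
        + ∑ x : Fin m, 1 / 2 * (B i x.succ 0 * w.1 x * q.1 0)
        = ∑ x : Fin m, w.1 x * (q.1 0 * B i x.succ 0) := by
      rw [← Finset.sum_add_distrib]
      refine Finset.sum_congr rfl fun x _ => by ring
    have e2 : ∑ x : Fin m, ∑ y : Fin m, 1 / 2 * (B i x.succ y.succ * q.1 y.succ * w.1 x)
        = ∑ x : Fin m, ∑ y : Fin m, w.1 x * (1 / 2 * (B i x.succ y.succ * q.1 y.succ)) :=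
      Finset.sum_congr rfl fun x _ => Finset.sum_congr rfl fun y _ => by ring
    have e3 : ∑ x : Fin m, 1 / 2 * (B i x.succ 0 * q.1 x.succ * q.1 0)
        = ∑ x : Fin m, 1 / 2 * q.1 0 * (q.1 x.succ * B i x.succ 0) :=
      Finset.sum_congr rfl fun x _ => by ring
    simp only [add_zero, zero_mul, mul_zero, zero_add, Finset.sum_const_zero]
    linarith

theorem pmap_left_inv {m h : ℕ} {B : Fin h → Matrix (Fin (m + 1)) (Fin (m + 1)) ℝ}
    (hskew : ∀ i, (B i)ᵀ = -(B i)) (q : (Fin (m + 1) → ℝ) × (Fin h → ℝ))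
    (w : (Fin m → ℝ) × (Fin h → ℝ)) :
    step2Pmap B (step2Inv q) (step2Pmap B q w) = w := by
  rw [pmap_eq hskew, pmap_eq hskew]
  ext i
  · simp [pA_apply, pC, step2Inv]
  · have hneg : ∀ k, pL B (step2Inv q) i k = - pL B q i k := by
      intro k; simp [pL, step2Inv]; ring
    have hz : ∑ k : Fin m, ∑ j : Fin m, q.1 k.succ * (B i k.succ j.succ * q.1 j.succ) = 0 := by
      have h1 : ∑ k : Fin m, ∑ j : Fin m, q.1 k.succ * (B i k.succ j.succ * q.1 j.succ)
          = - ∑ k : Fin m, ∑ j : Fin m, q.1 k.succ * (B i k.succ j.succ * q.1 j.succ) := by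
        conv_lhs => rw [Finset.sum_comm]
        rw [← Finset.sum_neg_distrib]
        refine Finset.sum_congr rfl fun k _ => ?_
        rw [← Finset.sum_neg_distrib]
        refine Finset.sum_congr rfl fun j _ => ?_
        rw [skew_apply hskew i j.succ k.succ]; ring
      linarith
    have hq : ∑ k : Fin m, q.1 k.succ * pL B q i k
        = q.1 0 * ∑ k : Fin m, q.1 k.succ * B i k.succ 0 := by
      have : ∑ k : Fin m, q.1 k.succ * pL B q i k
        = (1 / 2) * ∑ k : Fin m, ∑ j : Fin m, q.1 k.succ * (B i k.succ j.succ * q.1 j.succ)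
          + q.1 0 * ∑ k : Fin m, q.1 k.succ * B i k.succ 0 := by
        rw [Finset.mul_sum, Finset.mul_sum, ← Finset.sum_add_distrib]
        refine Finset.sum_congr rfl fun k _ => ?_
        rw [← Finset.mul_sum, pL]; ring
      rw [this, hz]; ring
    simp only [pA_apply, pC, Prod.fst_add, Prod.snd_add, Pi.add_apply, hneg, add_mul,
      Finset.sum_add_distrib, mul_neg, Finset.sum_neg_distrib]
    rw [hq]
    simp only [step2Inv, Prod.fst_neg, Prod.snd_neg, Pi.neg_apply, neg_mul,
      Finset.sum_neg_distrib]
    ring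

theorem step2Inv_inv {m h : ℕ} (q : (Fin (m + 1) → ℝ) × (Fin h → ℝ)) :
    step2Inv (step2Inv q) = q := by
  simp [step2Inv]

theorem pmap_cont {m h : ℕ} {B : Fin h → Matrix (Fin (m + 1)) (Fin (m + 1)) ℝ}
    (hskew : ∀ i, (B i)ᵀ = -(B i)) (q : (Fin (m + 1) → ℝ) × (Fin h → ℝ)) :
    Continuous (step2Pmap B q) := by
  have : step2Pmap B q = fun w => pA B q w + pC B q := funext (pmap_eq hskew q)
  rw [this]; fun_prop

/-- `P_q` as a homeomorphism. -/
noncomputable def pH {m h : ℕ} {B : Fin h → Matrix (Fin (m + 1)) (Fin (m + 1)) ℝ}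
    (hskew : ∀ i, (B i)ᵀ = -(B i)) (q : (Fin (m + 1) → ℝ) × (Fin h → ℝ)) :
    ((Fin m → ℝ) × (Fin h → ℝ)) ≃ₜ ((Fin m → ℝ) × (Fin h → ℝ)) where
  toFun := step2Pmap B q
  invFun := step2Pmap B (step2Inv q)
  left_inv := pmap_left_inv hskew q
  right_inv := by
    intro w
    have := pmap_left_inv hskew (step2Inv q) w
    rwa [step2Inv_inv] at this
  continuous_toFun := pmap_cont hskew q
  continuous_invFun := pmap_cont hskew _

theorem pmap_mp {m h : ℕ} {B : Fin h → Matrix (Fin (m + 1)) (Fin (m + 1)) ℝ}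
    (hskew : ∀ i, (B i)ᵀ = -(B i)) (q : (Fin (m + 1) → ℝ) × (Fin h → ℝ)) :
    MeasurePreserving (step2Pmap B q) volume volume := by
  have e : step2Pmap B q = fun w : (Fin m → ℝ) × (Fin h → ℝ) => (w.1 + (pC B q).1,
      w.2 + (fun i => (pC B q).2 i - ∑ k, w.1 k * pL B q i k)) := by
    funext w
    rw [pmap_eq hskew, pA_apply]
    ext i
    · simp
    · simp; ring
  rw [e]
  refine MeasurePreserving.skew_product (g := fun (x : Fin m → ℝ) (y : Fin h → ℝ) =>
    y + (fun i => (pC B q).2 i - ∑ k, x k * pL B q i k))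
    (measurePreserving_add_right volume (pC B q).1) ?_ ?_
  · apply Continuous.measurable
    simp only [Function.uncurry_def]
    fun_prop
  · exact Filter.Eventually.of_forall fun x => (measurePreserving_add_right volume _).map_eq

theorem integral_zero_aux {E : Type*} [NormedAddCommGroup E] [NormedSpace ℝ E]
    [FiniteDimensional ℝ E] [MeasurableSpace E] [BorelSpace E] (μ : Measure E)
    [μ.IsAddHaarMeasure] (f ξ : E → ℝ) (v : E) (hf : ContDiff ℝ 1 f)
    (hfv : ∀ w, fderiv ℝ f w v = 0)
    (hξ : ContDiff ℝ 1 ξ) (hc : HasCompactSupport ξ) :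
    Integrable (fun w => f w * fderiv ℝ ξ w v) μ ∧ ∫ w, f w * fderiv ℝ ξ w v ∂μ = 0 := by
  have hcv : HasCompactSupport (fun w => fderiv ℝ ξ w v) := hc.fderiv_apply ℝ v
  have hcont : Continuous (fun w => fderiv ℝ ξ w v) :=
    (hξ.continuous_fderiv one_ne_zero).clm_apply continuous_const
  have h1 : Integrable (fun w => f w * fderiv ℝ ξ w v) μ :=
    (hf.continuous.mul hcont).integrable_of_hasCompactSupport hcv.mul_left
  refine ⟨h1, ?_⟩
  rw [integral_mul_fderiv_eq_neg_fderiv_mul_of_integrable (μ := μ) (f := f) (g := ξ) (v := v)]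
  · simp [hfv]
  · simp [hfv]
  · exact h1
  · exact (hf.continuous.mul hξ.continuous).integrable_of_hasCompactSupport hc.mul_left
  · intro x _; exact hf.differentiable one_ne_zero x
  · intro x _; exact hξ.differentiable one_ne_zero x

theorem integral_add_zero_aux {E : Type*} [MeasurableSpace E] (μ : Measure E)
    (F D : E → ℝ) (hD : Integrable D μ) (h0 : ∫ w, D w ∂μ = 0) :
    ∫ w, (F w + D w) ∂μ = ∫ w, F w ∂μ := by
  by_cases hF : Integrable F μ
  · rw [integral_add hF hD, h0, add_zero]
  · rw [integral_undef hF, integral_undef]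
    intro h
    apply hF
    have := h.sub hD
    refine this.congr (Filter.Eventually.of_forall fun w => ?_)
    simp

theorem stmt_14 (m h : ℕ) (B : Fin h → Matrix (Fin (m + 1)) (Fin (m + 1)) ℝ)
    (hskew : ∀ i, (B i)ᵀ = -(B i)) (hli : LinearIndependent ℝ B)
    (U : Set ((Fin m → ℝ) × (Fin h → ℝ))) (hU : IsOpen U)
    (φ ω : ((Fin m → ℝ) × (Fin h → ℝ)) → ℝ) (hφ : ContinuousOn φ U)
    (hω : LocallyIntegrableOn ω U)
    (ℓ : Fin m) (hsol : IsDistrSol B ℓ U φ ω) :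
    ∀ q : (Fin (m + 1) → ℝ) × (Fin h → ℝ),
      IsDistrSol B ℓ (step2Pmap B q '' U)
        (fun w => q.1 0 + φ (step2Pmap B (step2Inv q) w))
        (fun w => ω (step2Pmap B (step2Inv q) w)) := by
  intro q ξ hξ hc hs
  have hemb : MeasurableEmbedding (step2Pmap B q) := (pH hskew q).measurableEmbedding
  have hmp := pmap_mp hskew q
  rw [hmp.setIntegral_image_emb hemb, hmp.setIntegral_image_emb hemb]
  simp only [pmap_left_inv hskew q]
  have hPfun : step2Pmap B q = fun w => pA B q w + pC B q := funext (pmap_eq hskew q)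
  have hPd : ∀ w, HasFDerivAt (step2Pmap B q) (pA B q) w := by
    intro w
    rw [hPfun]
    exact (pA B q).hasFDerivAt.add_const _
  have hPc : ContDiff ℝ (⊤ : ℕ∞) (step2Pmap B q) := by
    rw [hPfun]; exact (pA B q).contDiff.add contDiff_const
  have hts : tsupport (ξ ∘ step2Pmap B q) = step2Pmap B q ⁻¹' tsupport ξ :=
    tsupport_comp_eq_preimage ξ (pH hskew q)
  have key := hsol (ξ ∘ step2Pmap B q) (hξ.comp hPc)
    (hc.comp_homeomorph (pH hskew q)) (by
      rw [hts]
      intro w hw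
      obtain ⟨u, hu, huw⟩ := hs hw
      rwa [← (pH hskew q).injective huw])
  have hfd : ∀ w u, fderiv ℝ (ξ ∘ step2Pmap B q) w u
      = fderiv ℝ ξ (step2Pmap B q w) (pA B q u) := by
    intro w u
    have h1 : HasFDerivAt ξ (fderiv ℝ ξ (step2Pmap B q w)) (step2Pmap B q w) :=
      (hξ.differentiable (by simp) _).hasFDerivAt
    rw [(h1.comp w (hPd w)).fderiv]
    rfl
  have hAi : ∀ i : Fin h, pA B q (0, Pi.single i 1) = (0, Pi.single i 1) := by
    intro i
    rw [pA_apply]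
    simp
  have hAl : pA B q (Pi.single ℓ 1, 0)
      = (Pi.single ℓ 1, 0) - ∑ i, pL B q i ℓ • ((0, Pi.single i 1) : (Fin m → ℝ) × (Fin h → ℝ)) := by
    rw [pA_apply]
    ext i
    · simp [Prod.fst_sum]
    · simp [Prod.snd_sum, Pi.single_apply]
  simp only [hfd, hAi, hAl, map_sub, map_sum, map_smul, smul_eq_mul, Function.comp_apply] at key
  rw [← key]
  have hξ1 : ContDiff ℝ 1 ξ := hξ.of_le (by exact_mod_cast le_top)
  haveI hHaar : (volume : Measure ((Fin m → ℝ) × (Fin h → ℝ))).IsAddHaarMeasure :=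
    Measure.prod.instIsAddHaarMeasure (volume : Measure (Fin m → ℝ)) (volume : Measure (Fin h → ℝ))
  obtain ⟨hI0, hZ0⟩ := integral_zero_aux (volume : Measure ((Fin m → ℝ) × (Fin h → ℝ)))
    (fun _ => - q.1 0) ξ (Pi.single ℓ 1, 0)
    contDiff_const (by simp) hξ1 hc
  have hi := fun i : Fin h => integral_zero_aux (volume : Measure ((Fin m → ℝ) × (Fin h → ℝ)))
    (fun w : (Fin m → ℝ) × (Fin h → ℝ) => (1 / 2) * B i ℓ.succ 0 * (q.1 0) ^ 2
      + (1 / 2) * (∑ k : Fin m, w.1 k * B i ℓ.succ k.succ) * q.1 0) ξ (0, Pi.single i 1)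
    (by fun_prop) (by
      intro w
      have hd : DifferentiableAt ℝ (fun x : Fin m → ℝ => (1 / 2) * B i ℓ.succ 0 * (q.1 0) ^ 2
        + (1 / 2) * (∑ k : Fin m, x k * B i ℓ.succ k.succ) * q.1 0) w.1 := by fun_prop
      have := hd.hasFDerivAt.comp w (hasFDerivAt_fst (𝕜 := ℝ) (p := w))
      have h2 := this.fderiv
      simp only [Function.comp_def] at h2
      rw [h2]
      simp) hξ1 hc
  have hDint := hI0.add (integrable_finsetSum Finset.univ fun i _ => (hi i).1)
  have hDzero := integral_add hI0 (integrable_finsetSum Finset.univ fun i _ => (hi i).1)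
  rw [hZ0, integral_finsetSum _ fun i _ => (hi i).1,
    Finset.sum_eq_zero fun i _ => (hi i).2, add_zero] at hDzero
  have hDint' := (hmp.integrable_comp_emb hemb).2 hDint
  rw [← hmp.integral_comp hemb] at hDzero
  rw [← setIntegral_eq_integral_of_forall_compl_eq_zero (s := U)] at hDzero
  · refine Eq.trans ?_ (integral_add_zero_aux _ _ _ hDint'.integrableOn hDzero)
    congr 1
    funext w
    have hw : ∀ k, (step2Pmap B q w).1 k = w.1 k + q.1 k.succ := by
      intro k; rw [pmap_eq hskew]; simp [pA_apply, pC]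
    simp only [Function.comp_apply, Pi.add_apply, hw]
    generalize fderiv ℝ ξ (step2Pmap B q w) = T
    have hG : ∀ i, (1 / 2 * B i ℓ.succ 0 * (q.1 0 + φ w) ^ 2
          + 1 / 2 * (∑ k : Fin m, (w.1 k + q.1 k.succ) * B i ℓ.succ k.succ) * (q.1 0 + φ w))
            * T (0, Pi.single i 1)
        = φ w * (pL B q i ℓ * T (0, Pi.single i 1))
          + (1 / 2 * B i ℓ.succ 0 * φ w ^ 2
            + 1 / 2 * (∑ k : Fin m, w.1 k * B i ℓ.succ k.succ) * φ w) * T (0, Pi.single i 1)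
          + (1 / 2 * B i ℓ.succ 0 * q.1 0 ^ 2
            + 1 / 2 * (∑ k : Fin m, (w.1 k + q.1 k.succ) * B i ℓ.succ k.succ) * q.1 0)
              * T (0, Pi.single i 1) := by
      intro i
      have e : ∑ k : Fin m, (w.1 k + q.1 k.succ) * B i ℓ.succ k.succ
          = ∑ k : Fin m, w.1 k * B i ℓ.succ k.succ
            + ∑ k : Fin m, B i ℓ.succ k.succ * q.1 k.succ := by
        rw [← Finset.sum_add_distrib]
        exact Finset.sum_congr rfl fun k _ => by ring
      rw [e, pL]
      ring
    rw [Finset.sum_congr rfl fun i _ => hG i, Finset.sum_add_distrib, Finset.sum_add_distrib,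
      ← Finset.mul_sum]
    ring
  · intro w hw
    have hz : fderiv ℝ ξ (step2Pmap B q w) = 0 := by
      apply fderiv_of_notMem_tsupport
      intro hmem
      obtain ⟨u, hu, huw⟩ := hs hmem
      apply hw
      rwa [← (pH hskew q).injective huw]
    simp [hz]
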